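/- arXiv:2006.10109 — 5 statements merged into one kernel-verified Lean document; each statement's English description precedes it below -/
import Mathlib

section
/- The distancing game has a unique symmetric Nash equilibrium: there exists exactly one d* ∈ [0,1] such that (MG(d*) ≤ MC(d*) or d* = 1) and (MG(d*) ≥ MC(d*) or d* = 0). Moreover this d* is characterized as follows: (i) if MG(0) ≤ MC(0) then d* = 0; (ii) if MG(1) ≥ MC(1) then d* = 1; (iii) if MG(0) > MC(0) and MG(1) < MC(1) then d* = (K − a₁ − a₂(N + R)) / (α(K − a₂N)) and d* ∈ (0,1). -/
/-- Proposition 1 (Nash SIR, McAdams 2020): the time-t distancing game has a unique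
symmetric Nash equilibrium `d*`, characterized case-by-case: (i) if `MG 0 ≤ MC 0` then
`d* = 0`; (ii) if `MG 1 ≥ MC 1` then `d* = 1`; (iii) if `MG 0 > MC 0` and `MG 1 < MC 1`
then `d* = (K − a₁ − a₂(N+R)) / (α(K − a₂N)) ∈ (0,1)`. -/
theorem distancing_game_unique_symmetric_NE
    (α a₁ a₂ β S C H N I R K : ℝ) (MG MC : ℝ → ℝ)
    (hα : 0 < α) (hα1 : α ≤ 1) (ha₁ : 0 < a₁) (ha₂ : 0 < a₂) (hβ : 0 < β)
    (hS : 0 ≤ S) (hC : 0 ≤ C) (hN : 0 < N) (hI : 0 ≤ I) (hR : 0 ≤ R)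
    (hsum : N + I + R = 1)
    (hK : K = β * S * C * H / N)
    (hMG : ∀ d, MG d = α * (1 - α * d) * K)
    (hMC : ∀ d, MC d = α * (a₁ + a₂ * ((1 - α * d) * N + R))) :
    (∃! d : ℝ, d ∈ Set.Icc (0:ℝ) 1 ∧ (MG d ≤ MC d ∨ d = 1) ∧ (MC d ≤ MG d ∨ d = 0)) ∧
    (∀ d : ℝ, d ∈ Set.Icc (0:ℝ) 1 ∧ (MG d ≤ MC d ∨ d = 1) ∧ (MC d ≤ MG d ∨ d = 0) →
      (MG 0 ≤ MC 0 → d = 0) ∧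
      (MC 1 ≤ MG 1 → d = 1) ∧
      (MC 0 < MG 0 → MG 1 < MC 1 →
        d = (K - a₁ - a₂ * (N + R)) / (α * (K - a₂ * N)) ∧ 0 < d ∧ d < 1)) := by
  obtain ⟨P, hP⟩ : ∃ P, P = K - a₂ * N := ⟨_, rfl⟩
  obtain ⟨Q, hQ⟩ : ∃ Q, Q = a₁ + a₂ * R := ⟨_, rfl⟩
  have hQ0 : 0 < Q := by rw [hQ]; positivity
  have hdiff : ∀ d, MG d - MC d = α * ((1 - α * d) * P - Q) := by
    intro d; rw [hMG, hMC, hP, hQ]; ring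
  have hle : ∀ d, MG d ≤ MC d ↔ (1 - α * d) * P ≤ Q := by
    intro d
    rw [← sub_nonpos, hdiff]
    constructor
    · intro h; linarith [nonpos_of_mul_nonpos_right h hα]
    · intro h
      exact mul_nonpos_of_nonneg_of_nonpos hα.le (by linarith)
  have hge : ∀ d, MC d ≤ MG d ↔ Q ≤ (1 - α * d) * P := by
    intro d
    rw [← sub_nonneg, hdiff, mul_nonneg_iff_of_pos_left hα, sub_nonneg]
  have hnum : K - a₁ - a₂ * (N + R) = P - Q := by rw [hP, hQ]; ring
  rw [hnum, ← hP]
  have key : ∀ d : ℝ, d ∈ Set.Icc (0:ℝ) 1 ∧ (MG d ≤ MC d ∨ d = 1) ∧ (MC d ≤ MG d ∨ d = 0) →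
      (MG 0 ≤ MC 0 → d = 0) ∧
      (MC 1 ≤ MG 1 → d = 1) ∧
      (MC 0 < MG 0 → MG 1 < MC 1 →
        d = (P - Q) / (α * P) ∧ 0 < d ∧ d < 1) := by
    rintro d ⟨⟨h0, h1⟩, hA, hB⟩
    have hαd : 0 ≤ 1 - α * d := by nlinarith
    refine ⟨fun h => ?_, fun h => ?_, fun h h' => ?_⟩
    · rcases hB with hB | hB
      · rw [hge] at hB
        rw [hle] at h
        have hPpos : 0 < P := pos_of_mul_pos_right (lt_of_lt_of_le hQ0 hB) hαd
        have h2 : (α * P) * d ≤ 0 := by linarith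
        have h3 := nonpos_of_mul_nonpos_right h2 (mul_pos hα hPpos)
        linarith
      · exact hB
    · rcases hA with hA | hA
      · rw [hle] at hA
        rw [hge] at h
        have hPpos : 0 < P := pos_of_mul_pos_right (lt_of_lt_of_le hQ0 h) (by linarith)
        have h2 : (α * P) * (1 - d) ≤ 0 := by linarith
        have h3 := nonpos_of_mul_nonpos_right h2 (mul_pos hα hPpos)
        linarith
      · exact hA
    · have hd0 : d ≠ 0 := by
        rintro rfl
        rcases hA with hA | hA
        · linarith
        · norm_num at hA
      have hd1 : d ≠ 1 := by
        rintro rfl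
        rcases hB with hB | hB
        · linarith
        · norm_num at hB
      have hA' := (hle d).1 (hA.resolve_right hd1)
      have hB' := (hge d).1 (hB.resolve_right hd0)
      have h2 : Q < (1 - α * 0) * P := by
        by_contra hc
        exact absurd ((hle 0).2 (not_lt.1 hc)) (not_le.2 h)
      have hPpos : 0 < P := by linarith
      refine ⟨?_, lt_of_le_of_ne h0 hd0.symm, lt_of_le_of_ne h1 hd1⟩
      rw [eq_div_iff (mul_pos hα hPpos).ne']
      linarith
  refine ⟨?_, key⟩
  have hex : ∃ d : ℝ, d ∈ Set.Icc (0:ℝ) 1 ∧ (MG d ≤ MC d ∨ d = 1) ∧ (MC d ≤ MG d ∨ d = 0) := by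
    by_cases h : MG 0 ≤ MC 0
    · exact ⟨0, by simp, Or.inl h, Or.inr rfl⟩
    by_cases h' : MC 1 ≤ MG 1
    · exact ⟨1, by simp, Or.inr rfl, Or.inl h'⟩
    rw [hle] at h
    rw [hge] at h'
    have hPpos : 0 < P := by linarith
    have hαP := mul_pos hα hPpos
    have he : (1 - α * ((P - Q) / (α * P))) * P = Q := by
      field_simp
      ring
    refine ⟨(P - Q) / (α * P), ⟨div_nonneg (by linarith) hαP.le, ?_⟩,
      Or.inl ((hle _).2 he.le), Or.inl ((hge _).2 he.ge)⟩
    rw [div_le_one hαP]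
    linarith
  obtain ⟨d, hd⟩ := hex
  refine ⟨d, hd, fun e he => ?_⟩
  have kd := key d hd
  have ke := key e he
  by_cases h : MG 0 ≤ MC 0
  · rw [kd.1 h, ke.1 h]
  by_cases h' : MC 1 ≤ MG 1
  · rw [kd.2.1 h', ke.2.1 h']
  rw [(kd.2.2 (not_le.1 h) (not_le.1 h')).1, (ke.2.2 (not_le.1 h) (not_le.1 h')).1]
end

section
/- If MG(0) ≤ MC(0), then MG(d) < MC(d) for every d ∈ (0,1]; in particular not distancing is a dominant strategy and d* = 0 is the unique symmetric Nash equilibrium of the distancing game. -/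
/-- Case (i) of Proposition 1 (Nash SIR, McAdams 2020): if `MG 0 ≤ MC 0` then
`MG d < MC d` for every `d ∈ (0,1]`; not distancing is a dominant strategy and
`d* = 0` is the unique symmetric Nash equilibrium of the distancing game. -/
theorem no_distancing_dominant
    (α a₁ a₂ β S C H N I R K : ℝ) (MG MC : ℝ → ℝ)
    (hα : 0 < α) (hα1 : α ≤ 1) (ha₁ : 0 < a₁) (ha₂ : 0 < a₂) (hβ : 0 < β)
    (hS : 0 ≤ S) (hC : 0 ≤ C) (hN : 0 < N) (hI : 0 ≤ I) (hR : 0 ≤ R)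
    (hsum : N + I + R = 1)
    (hK : K = β * S * C * H / N)
    (hMG : ∀ d, MG d = α * (1 - α * d) * K)
    (hMC : ∀ d, MC d = α * (a₁ + a₂ * ((1 - α * d) * N + R)))
    (h0 : MG 0 ≤ MC 0) :
    (∀ d : ℝ, 0 < d → d ≤ 1 → MG d < MC d) ∧
    ((0:ℝ) ∈ Set.Icc (0:ℝ) 1 ∧ (MG 0 ≤ MC 0 ∨ (0:ℝ) = 1) ∧ (MC 0 ≤ MG 0 ∨ (0:ℝ) = 0)) ∧
    (∀ d : ℝ, d ∈ Set.Icc (0:ℝ) 1 ∧ (MG d ≤ MC d ∨ d = 1) ∧ (MC d ≤ MG d ∨ d = 0) →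
      d = 0) := by
  have key : ∀ d : ℝ, 0 < d → d ≤ 1 → MG d < MC d := by
    intro d hd hd1
    rw [hMG, hMC] at h0
    rw [hMG, hMC, mul_assoc]
    apply mul_lt_mul_of_pos_left _ hα
    have hK' : K ≤ a₁ + a₂ * (N + R) := by
      have h1 : α * K ≤ α * (a₁ + a₂ * (N + R)) := by simpa using h0
      exact le_of_mul_le_mul_left h1 hα
    have ht0 : 0 ≤ 1 - α * d := by nlinarith
    have hp : 0 < α * d := mul_pos hα hd
    have h2 := mul_le_mul_of_nonneg_left hK' ht0
    have h3 : 0 < α * d * a₁ := mul_pos hp ha₁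
    have h4 : 0 ≤ α * d * (a₂ * R) := by positivity
    nlinarith
  refine ⟨key, ⟨by simp, Or.inl h0, Or.inr rfl⟩, ?_⟩
  rintro d ⟨⟨hd0, hd1⟩, -, h | h⟩
  · by_contra hne
    exact absurd (key d (lt_of_le_of_ne hd0 (Ne.symm hne)) hd1) (not_lt.mpr h)
  · exact h
end

section
/- If MG(1) ≥ MC(1), then MG(d) > MC(d) for every d ∈ [0,1); in particular distancing fully is a dominant strategy and d* = 1 is the unique symmetric Nash equilibrium of the distancing game. -/
/-- Case (ii) of Proposition 1 (Nash SIR, McAdams 2020): if `MG 1 ≥ MC 1` then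
`MG d > MC d` for every `d ∈ [0,1)`; full distancing is a dominant strategy and
`d* = 1` is the unique symmetric Nash equilibrium of the distancing game. -/
theorem maximal_distancing_dominant
    (α a₁ a₂ β S C H N I R K : ℝ) (MG MC : ℝ → ℝ)
    (hα : 0 < α) (hα1 : α ≤ 1) (ha₁ : 0 < a₁) (ha₂ : 0 < a₂) (hβ : 0 < β)
    (hS : 0 ≤ S) (hC : 0 ≤ C) (hN : 0 < N) (hI : 0 ≤ I) (hR : 0 ≤ R)
    (hsum : N + I + R = 1)
    (hK : K = β * S * C * H / N)
    (hMG : ∀ d, MG d = α * (1 - α * d) * K)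
    (hMC : ∀ d, MC d = α * (a₁ + a₂ * ((1 - α * d) * N + R)))
    (h1 : MC 1 ≤ MG 1) :
    (∀ d : ℝ, 0 ≤ d → d < 1 → MC d < MG d) ∧
    ((1:ℝ) ∈ Set.Icc (0:ℝ) 1 ∧ (MG 1 ≤ MC 1 ∨ (1:ℝ) = 1) ∧ (MC 1 ≤ MG 1 ∨ (1:ℝ) = 0)) ∧
    (∀ d : ℝ, d ∈ Set.Icc (0:ℝ) 1 ∧ (MG d ≤ MC d ∨ d = 1) ∧ (MC d ≤ MG d ∨ d = 0) →
      d = 1) := by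
  have key : ∀ d : ℝ, 0 ≤ d → d < 1 → MC d < MG d := by
    intro d _ hd1
    rw [hMG, hMC] at h1
    rw [hMG, hMC, mul_assoc]
    rw [mul_assoc] at h1
    have h2 := le_of_mul_le_mul_left h1 hα
    apply mul_lt_mul_of_pos_left _ hα
    have hRa : 0 ≤ a₂ * R := by positivity
    have h3 : a₁ + a₂ * R ≤ (1 - α) * (K - a₂ * N) := by linarith
    have h4 : 0 < K - a₂ * N := by
      by_contra hneg
      have : (1 - α) * (K - a₂ * N) ≤ 0 :=
        mul_nonpos_of_nonneg_of_nonpos (by linarith) (not_lt.mp hneg)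
      linarith
    have h5 : 0 < α * (1 - d) * (K - a₂ * N) :=
      mul_pos (mul_pos hα (by linarith)) h4
    linarith
  refine ⟨key, ⟨⟨zero_le_one, le_refl _⟩, Or.inr rfl, Or.inl h1⟩, ?_⟩
  rintro d ⟨⟨hd0, hd1⟩, h, _⟩
  rcases h with h | h
  · by_contra hne
    exact absurd (key d hd0 (lt_of_le_of_ne hd1 hne)) (not_lt.mpr h)
  · exact h
end

section
/- If MG(0) > MC(0) and MG(1) < MC(1), then there exists a unique d* ∈ (0,1) with MG(d*) = MC(d*), given explicitly by d* = (K − a₁ − a₂(N + R)) / (α(K − a₂N)); moreover MG(d) > MC(d) for all d < d* and MG(d) < MC(d) for all d > d*. -/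
/-- Case (iii) of Proposition 1 (Nash SIR, McAdams 2020): if `MG 0 > MC 0` and
`MG 1 < MC 1`, there is a unique interior `d* ∈ (0,1)` with `MG d* = MC d*`, given by
`d* = (K − a₁ − a₂(N+R)) / (α(K − a₂N))`; moreover `MG > MC` below `d*` and
`MG < MC` above `d*`. -/
theorem interior_equilibrium
    (α a₁ a₂ β S C H N I R K : ℝ) (MG MC : ℝ → ℝ)
    (hα : 0 < α) (hα1 : α ≤ 1) (ha₁ : 0 < a₁) (ha₂ : 0 < a₂) (hβ : 0 < β)
    (hS : 0 ≤ S) (hC : 0 ≤ C) (hN : 0 < N) (hI : 0 ≤ I) (hR : 0 ≤ R)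
    (hsum : N + I + R = 1)
    (hK : K = β * S * C * H / N)
    (hMG : ∀ d, MG d = α * (1 - α * d) * K)
    (hMC : ∀ d, MC d = α * (a₁ + a₂ * ((1 - α * d) * N + R)))
    (h0 : MC 0 < MG 0) (h1 : MG 1 < MC 1) :
    ∃ dstar : ℝ,
      dstar = (K - a₁ - a₂ * (N + R)) / (α * (K - a₂ * N)) ∧
      0 < dstar ∧ dstar < 1 ∧
      MG dstar = MC dstar ∧
      (∀ d : ℝ, 0 ≤ d → d < dstar → MC d < MG d) ∧
      (∀ d : ℝ, dstar < d → d ≤ 1 → MG d < MC d) ∧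
      (∀ d : ℝ, 0 < d → d < 1 → MG d = MC d → d = dstar) := by
  have hd : ∀ d, MG d - MC d =
      α * ((K - a₁ - a₂ * (N + R)) - d * (α * (K - a₂ * N))) := by
    intro d
    rw [hMG, hMC]
    ring
  have e0 := hd 0
  have e1 := hd 1
  generalize (K - a₁ - a₂ * (N + R)) = P at *
  generalize (α * (K - a₂ * N)) = D at *
  have hP : 0 < P := by
    have : 0 < α * (P - 0 * D) := by linarith
    have := pos_of_mul_pos_right this hα.le
    linarith
  have hPD : P < D := by
    have : 0 < α * (D - P) := by linarith
    have := pos_of_mul_pos_right this hα.le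
    linarith
  have hD : 0 < D := by linarith
  refine ⟨P / D, rfl, by positivity, (div_lt_one hD).2 hPD, ?_, ?_, ?_, ?_⟩
  · have := hd (P / D)
    rw [div_mul_cancel₀ _ hD.ne'] at this
    linarith
  · intro d _ h
    rw [lt_div_iff₀ hD] at h
    have := mul_pos hα (sub_pos.2 h)
    linarith [hd d]
  · intro d h _
    rw [div_lt_iff₀ hD] at h
    have := mul_pos hα (sub_pos.2 h)
    linarith [hd d]
  · intro d _ _ h
    have h2 := hd d
    rw [h, sub_self] at h2
    rw [eq_div_iff hD.ne']
    rcases mul_eq_zero.1 h2.symm with h3 | h3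
    · exact absurd h3 hα.ne'
    · linarith
end

section
/- Whenever the distancing game has (weak) strategic complements, i.e. K ≤ a₂N, agents have a dominant strategy: either MG(0) ≤ MC(0) (so MG(d) < MC(d) for all d ∈ (0,1] and not distancing is dominant) or MG(1) ≥ MC(1) (so MG(d) > MC(d) for all d ∈ [0,1) and distancing is dominant); in particular, the case MG(0) > MC(0) and MG(1) < MC(1) cannot occur when K ≤ a₂N. -/
/-- When the distancing game has (weak) strategic complements, i.e. `K ≤ a₂N`
(Nash SIR, McAdams 2020), agents have a dominant strategy: either `MG 0 ≤ MC 0`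
(and `MG d < MC d` on `(0,1]`, so not distancing is dominant) or `MG 1 ≥ MC 1`
(and `MG d > MC d` on `[0,1)`, so distancing is dominant); the interior case
`MG 0 > MC 0 ∧ MG 1 < MC 1` cannot occur. -/
theorem strategic_complements_dominant_strategy
    (α a₁ a₂ β S C H N I R K : ℝ) (MG MC : ℝ → ℝ)
    (hα : 0 < α) (hα1 : α ≤ 1) (ha₁ : 0 < a₁) (ha₂ : 0 < a₂) (hβ : 0 < β)
    (hS : 0 ≤ S) (hC : 0 ≤ C) (hN : 0 < N) (hI : 0 ≤ I) (hR : 0 ≤ R)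
    (hsum : N + I + R = 1)
    (hK : K = β * S * C * H / N)
    (hMG : ∀ d, MG d = α * (1 - α * d) * K)
    (hMC : ∀ d, MC d = α * (a₁ + a₂ * ((1 - α * d) * N + R)))
    (hcomp : K ≤ a₂ * N) :
    ((MG 0 ≤ MC 0 ∧ ∀ d : ℝ, 0 < d → d ≤ 1 → MG d < MC d) ∨
     (MC 1 ≤ MG 1 ∧ ∀ d : ℝ, 0 ≤ d → d < 1 → MC d < MG d)) ∧
    ¬(MC 0 < MG 0 ∧ MG 1 < MC 1) := by
  have key : ∀ d : ℝ, 0 ≤ d → d ≤ 1 → MG d < MC d := by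
    intro d h0 h1
    have h2 : 0 ≤ 1 - α * d := by nlinarith
    have h3 : 0 ≤ (1 - α * d) * (a₂ * N - K) := mul_nonneg h2 (by linarith)
    have h4 : 0 ≤ a₂ * R := mul_nonneg ha₂.le hR
    have h5 : 0 < α * (a₁ + a₂ * R + (1 - α * d) * (a₂ * N - K)) :=
      mul_pos hα (by linarith)
    rw [hMG, hMC]
    linarith
  have k0 := key 0 le_rfl zero_le_one
  exact ⟨Or.inl ⟨k0.le, fun d h0 h1 => key d h0.le h1⟩, fun h => lt_asymm h.1 k0⟩
end
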